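/- arXiv:1610.04077 — 3 statements merged into one kernel-verified Lean document; each statement's English description precedes it below -/
import Mathlib

section
/- For every prime power q and every odd integer n ≥ 1, the number of symmetric n×n matrices over 𝔽_q of rank at least n−1 equals q^n times the number of symmetric (n−1)×(n−1) matrices over 𝔽_q of rank at least n−2; that is, p_{n,q} = q^n · p_{n−1,q}. -/
namespace Matrix

variable {K : Type*} [Field K]

open scoped Classical in
theorem rank_fromCols_replicateCol {m n : Type*} [Fintype m] [Fintype n]
    (A : Matrix m n K) (v : m → K) :
    (fromCols A (replicateCol Unit v)).rank =
      A.rank + if v ∈ LinearMap.range A.mulVecLin then 0 else 1 := by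
  have hspan : Submodule.span K (Set.range (fromCols A (replicateCol Unit v)).col) =
      LinearMap.range A.mulVecLin ⊔ Submodule.span K {v} := by
    rw [range_mulVecLin, ← Submodule.span_union]
    congr 1
    ext w
    simp only [Set.mem_range, Sum.exists, Set.mem_union, Set.mem_singleton_iff]
    refine or_congr Iff.rfl ⟨fun ⟨_, h⟩ => h.symm, fun h => ⟨(), h.symm⟩⟩
  rw [rank_eq_finrank_span_cols, hspan]
  split_ifs with hv
  · rw [sup_eq_left.2 ((Submodule.span_singleton_le_iff_mem _ _).2 hv)]
    rfl
  · exact Submodule.finrank_sup_span_singleton hv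

open scoped Classical in
theorem rank_fromRows_replicateRow {m n : Type*} [Fintype m] [Fintype n]
    (A : Matrix m n K) (v : n → K) :
    (fromRows A (replicateRow Unit v)).rank =
      A.rank + if v ∈ LinearMap.range Aᵀ.mulVecLin then 0 else 1 := by
  rw [← rank_transpose, transpose_fromRows, transpose_replicateRow, rank_fromCols_replicateCol,
    rank_transpose]

variable {n : Type*}

/-- The matrix `B` bordered by the vector `v` on both sides, with corner entry `a`. -/
def border {K : Type*} (B : Matrix n n K) (v : n → K) (a : K) : Matrix (n ⊕ Unit) (n ⊕ Unit) K :=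
  fromBlocks B (replicateCol Unit v) (replicateRow Unit v) (of fun _ _ => a)

theorem isSymm_border {K : Type*} {B : Matrix n n K} (hB : B.IsSymm) (v : n → K) (a : K) :
    (border B v a).IsSymm :=
  hB.fromBlocks (transpose_replicateCol v) rfl

open scoped Classical in
theorem rank_border [Fintype n] {B : Matrix n n K} (hB : B.IsSymm) (v : n → K) (a : K) :
    (border B v a).rank = B.rank + (if ∃ y, B *ᵥ y = v ∧ v ⬝ᵥ y = a then 0 else 1) +
      if v ∈ LinearMap.range B.mulVecLin then 0 else 1 := by
  have hborder : border B v a = fromRows (fromCols B (replicateCol Unit v))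
      (replicateRow Unit (Sum.elim v fun _ => a)) := by
    ext (i | i) (j | j) <;> rfl
  have hmem : Sum.elim v (fun _ => a) ∈
      LinearMap.range (fromCols B (replicateCol Unit v))ᵀ.mulVecLin ↔
        ∃ y, B *ᵥ y = v ∧ v ⬝ᵥ y = a := by
    simp only [LinearMap.mem_range, mulVecLin_apply, transpose_fromCols, hB.eq, fromRows_mulVec,
      Sum.elim_eq_iff, transpose_replicateCol, funext_iff (f := _ *ᵥ _)]
    simp [mulVec]
  rw [hborder, rank_fromRows_replicateRow, rank_fromCols_replicateCol, if_congr hmem rfl rfl]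
  ring

/-- A symmetric matrix with an extra index is a bordered symmetric matrix. -/
def borderEquiv (n K : Type*) [Field K] :
    {B : Matrix n n K // B.IsSymm} × (n → K) × K ≃
      {M : Matrix (n ⊕ Unit) (n ⊕ Unit) K // M.IsSymm} where
  toFun p := ⟨border p.1.1 p.2.1 p.2.2, isSymm_border p.1.2 _ _⟩
  invFun M := (⟨M.1.toBlocks₁₁, M.2.submatrix _⟩, fun i => M.1 (.inl i) (.inr ()),
    M.1 (.inr ()) (.inr ()))
  left_inv _ := rfl
  right_inv M := by
    ext (i | i) (j | j)
    · rfl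
    · rfl
    · exact M.2.apply _ _
    · rfl

theorem card_range_mulVecLin [Fintype n] [Fintype K] (B : Matrix n n K) :
    Nat.card (LinearMap.range B.mulVecLin) = Fintype.card K ^ B.rank := by
  rw [Module.natCard_eq_pow_finrank (K := K), Nat.card_eq_fintype_card]
  rfl

theorem card_exists_mulVec_eq_and_dotProduct_eq [Fintype n] [Fintype K] {B : Matrix n n K}
    (hB : B.IsSymm) :
    Nat.card {p : (n → K) × K // ∃ y, B *ᵥ y = p.1 ∧ p.1 ⬝ᵥ y = p.2} =
      Fintype.card K ^ B.rank := by
  rw [← card_range_mulVecLin]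
  refine Nat.card_eq_of_bijective
    (fun p => ⟨p.1.1, p.2.imp fun y hy => hy.1⟩) ⟨?_, ?_⟩
  · rintro ⟨⟨v, a⟩, y, hy, ha⟩ ⟨⟨v', a'⟩, z, hz, ha'⟩ h
    obtain rfl : v = v' := congrArg Subtype.val h
    have hsymm : (B *ᵥ z) ⬝ᵥ y = z ⬝ᵥ (B *ᵥ y) := by
      rw [dotProduct_mulVec, ← mulVec_transpose, hB.eq]
    dsimp only at hy ha hz ha'
    obtain rfl : a = a' := by rw [← ha, ← ha', dotProduct_comm v z, ← hz, hsymm, hy, hz]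
    rfl
  · rintro ⟨v, y, hy⟩
    exact ⟨⟨(v, v ⬝ᵥ y), y, hy, rfl⟩, rfl⟩

open scoped Classical in
theorem card_rank_border_eq [Fintype n] [Fintype K] {B : Matrix n n K} (hB : B.IsSymm) (k : ℕ) :
    (Nat.card {p : (n → K) × K // (border B p.1 p.2).rank = k} : ℤ) =
      (if B.rank = k then (Fintype.card K : ℤ) ^ B.rank else 0) +
      (if B.rank + 1 = k then
        (Fintype.card K : ℤ) ^ (B.rank + 1) - (Fintype.card K : ℤ) ^ B.rank else 0) +
      (if B.rank + 2 = k then (Fintype.card K : ℤ) ^ (Fintype.card n + 1) -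
        (Fintype.card K : ℤ) ^ (B.rank + 1) else 0) := by
  have h₀ := congrArg (Nat.cast (R := ℤ)) (card_exists_mulVec_eq_and_dotProduct_eq hB)
  have h₁ : (Nat.card {p : (n → K) × K // p.1 ∈ LinearMap.range B.mulVecLin} : ℤ) =
      (Fintype.card K : ℤ) ^ (B.rank + 1) := by
    rw [← Nat.card_congr (Equiv.prodSubtypeFstEquivSubtypeProd
      (p := (· ∈ LinearMap.range B.mulVecLin))).symm, Nat.card_prod]
    change ((Nat.card (LinearMap.range B.mulVecLin) * Nat.card K : ℕ) : ℤ) = _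
    rw [card_range_mulVecLin, Nat.card_eq_fintype_card]
    push_cast
    ring
  rw [Nat.card_eq_fintype_card, Fintype.card_subtype, Finset.natCast_card_filter] at h₀ h₁ ⊢
  have key : ∀ p : (n → K) × K, (if (border B p.1 p.2).rank = k then (1 : ℤ) else 0) =
      (if ∃ y, B *ᵥ y = p.1 ∧ p.1 ⬝ᵥ y = p.2 then 1 else 0) * (if B.rank = k then 1 else 0) +
      ((if p.1 ∈ LinearMap.range B.mulVecLin then 1 else 0) -
        (if ∃ y, B *ᵥ y = p.1 ∧ p.1 ⬝ᵥ y = p.2 then 1 else 0)) *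
          (if B.rank + 1 = k then 1 else 0) +
      (1 - (if p.1 ∈ LinearMap.range B.mulVecLin then 1 else 0)) *
          (if B.rank + 2 = k then 1 else 0) := by
    intro p
    have hsub : (∃ y, B *ᵥ y = p.1 ∧ p.1 ⬝ᵥ y = p.2) → p.1 ∈ LinearMap.range B.mulVecLin :=
      fun ⟨y, hy, _⟩ => ⟨y, hy⟩
    rw [rank_border hB]
    by_cases h₁ : p.1 ∈ LinearMap.range B.mulVecLin <;>
    by_cases h₀ : ∃ y, B *ᵥ y = p.1 ∧ p.1 ⬝ᵥ y = p.2
    · simp only [h₀, h₁]; simp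
    · simp only [h₀, h₁]; simp
    · exact absurd (hsub h₀) h₁
    · simp only [h₀, h₁]; simp
  simp only [key, Finset.sum_add_distrib, ← Finset.sum_mul, Finset.sum_sub_distrib, h₀, h₁]
  simp [pow_succ]

/-- The number of symmetric `m × m` matrices of rank `k` over `K`. -/
noncomputable def symmRankCard (K : Type*) [Field K] (m k : ℕ) : ℕ :=
  Nat.card {M : Matrix (Fin m) (Fin m) K // M.IsSymm ∧ M.rank = k}

theorem card_isSymm_rank_eq_symmRankCard [Fintype n] (m k : ℕ) (e : n ≃ Fin m) :
    Nat.card {M : Matrix n n K // M.IsSymm ∧ M.rank = k} = symmRankCard K m k := by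
  refine Nat.card_congr ((reindex e e).subtypeEquiv fun M => ?_)
  rw [rank_reindex, reindex_apply]
  refine and_congr_left' ⟨fun h => h.submatrix _, fun h => ?_⟩
  simpa using h.submatrix e

open scoped Classical in
theorem symmRankCard_succ [Fintype K] (m k : ℕ) :
    (symmRankCard K (m + 1) k : ℤ) =
      ∑ B : {B : Matrix (Fin m) (Fin m) K // B.IsSymm},
        ((if B.1.rank = k then (Fintype.card K : ℤ) ^ B.1.rank else 0) +
        (if B.1.rank + 1 = k then
          (Fintype.card K : ℤ) ^ (B.1.rank + 1) - (Fintype.card K : ℤ) ^ B.1.rank else 0) +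
        (if B.1.rank + 2 = k then (Fintype.card K : ℤ) ^ (m + 1) -
          (Fintype.card K : ℤ) ^ (B.1.rank + 1) else 0)) := by
  have e : {M : Matrix (Fin m ⊕ Unit) (Fin m ⊕ Unit) K // M.IsSymm ∧ M.rank = k} ≃
      Σ B : {B : Matrix (Fin m) (Fin m) K // B.IsSymm},
        {p : (Fin m → K) × K // (border B.1 p.1 p.2).rank = k} :=
    (Equiv.subtypeSubtypeEquivSubtypeInter _ (fun M => M.rank = k)).symm.trans <|
      ((borderEquiv (Fin m) K).subtypeEquiv fun _ => Iff.rfl).symm.trans <|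
      Equiv.subtypeProdEquivSigmaSubtype fun (B : {B : Matrix (Fin m) (Fin m) K // B.IsSymm})
        (p : (Fin m → K) × K) => (border B.1 p.1 p.2).rank = k
  rw [← card_isSymm_rank_eq_symmRankCard (m + 1) k
    ((Equiv.sumCongr (Equiv.refl _) (Equiv.ofUnique Unit (Fin 1))).trans finSumFinEquiv),
    Nat.card_congr e, Nat.card_sigma, Nat.cast_sum]
  refine Finset.sum_congr rfl fun B _ => ?_
  rw [card_rank_border_eq B.2, Fintype.card_fin]

open scoped Classical in
theorem sum_ite_rank_eq [Fintype K] (m k : ℕ) (c : ℕ → ℤ) :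
    ∑ B : {B : Matrix (Fin m) (Fin m) K // B.IsSymm}, (if B.1.rank = k then c B.1.rank else 0) =
      c k * symmRankCard K m k := by
  rw [symmRankCard, ← Nat.card_congr
    (Equiv.subtypeSubtypeEquivSubtypeInter _ (fun M : Matrix (Fin m) (Fin m) K => M.rank = k)),
    Nat.card_eq_fintype_card, Fintype.card_subtype, Finset.natCast_card_filter, Finset.mul_sum]
  refine Finset.sum_congr rfl fun B _ => ?_
  split_ifs with h <;> simp [h]

theorem symmRankCard_succ_zero [Fintype K] (m : ℕ) :
    symmRankCard K (m + 1) 0 = symmRankCard K m 0 := by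
  have h := symmRankCard_succ (K := K) m 0
  simp only [Nat.add_eq_zero_iff, one_ne_zero, two_ne_zero, and_false, if_false, add_zero,
    sum_ite_rank_eq m 0 (fun r => (Fintype.card K : ℤ) ^ r), pow_zero, one_mul] at h
  exact_mod_cast h

theorem symmRankCard_succ_one [Fintype K] (m : ℕ) :
    (symmRankCard K (m + 1) 1 : ℤ) = Fintype.card K * symmRankCard K m 1 +
      (Fintype.card K - 1) * symmRankCard K m 0 := by
  rw [symmRankCard_succ]
  simp only [Nat.add_eq_right, Nat.reduceEqDiff, if_false, add_zero, Finset.sum_add_distrib,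
    sum_ite_rank_eq m 1 (fun r => (Fintype.card K : ℤ) ^ r),
    sum_ite_rank_eq m 0 (fun r => (Fintype.card K : ℤ) ^ (r + 1) - (Fintype.card K : ℤ) ^ r)]
  simp

theorem symmRankCard_succ_add_two [Fintype K] (m k : ℕ) :
    (symmRankCard K (m + 1) (k + 2) : ℤ) =
      (Fintype.card K : ℤ) ^ (k + 2) * symmRankCard K m (k + 2) +
      ((Fintype.card K : ℤ) ^ (k + 2) - (Fintype.card K : ℤ) ^ (k + 1)) *
        symmRankCard K m (k + 1) +
      ((Fintype.card K : ℤ) ^ (m + 1) - (Fintype.card K : ℤ) ^ (k + 1)) *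
        symmRankCard K m k := by
  rw [symmRankCard_succ]
  simp only [Nat.add_right_cancel_iff, show ∀ r, r + 1 = k + 2 ↔ r = k + 1 by omega,
    Finset.sum_add_distrib,
    sum_ite_rank_eq m (k + 2) (fun r => (Fintype.card K : ℤ) ^ r),
    sum_ite_rank_eq m (k + 1)
      (fun r => (Fintype.card K : ℤ) ^ (r + 1) - (Fintype.card K : ℤ) ^ r),
    sum_ite_rank_eq m k
      (fun r => (Fintype.card K : ℤ) ^ (m + 1) - (Fintype.card K : ℤ) ^ (r + 1))]

theorem symmRankCard_eq_zero {m k : ℕ} (h : m < k) : symmRankCard K m k = 0 := by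
  have : IsEmpty {M : Matrix (Fin m) (Fin m) K // M.IsSymm ∧ M.rank = k} :=
    ⟨fun M => by have := M.1.rank_le_width; have := M.2.2; omega⟩
  exact Nat.card_of_isEmpty

theorem pow_mul_symmRankCard_two_mul_add_one [Fintype K] (m s : ℕ) :
    (Fintype.card K : ℤ) ^ (2 * s) * symmRankCard K m (2 * s + 1) =
      ((Fintype.card K : ℤ) ^ m - (Fintype.card K : ℤ) ^ (2 * s)) * symmRankCard K m (2 * s) := by
  induction m generalizing s with
  | zero =>
    rw [symmRankCard_eq_zero (by omega : 0 < 2 * s + 1)]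
    rcases s with _ | s
    · simp
    · rw [symmRankCard_eq_zero (by omega : 0 < 2 * (s + 1))]; simp
  | succ m ih =>
    have ih₁ := ih s
    rcases s with _ | s
    · simp only [mul_zero, zero_add, pow_zero, one_mul] at ih₁ ⊢
      rw [symmRankCard_succ_one, symmRankCard_succ_zero, ih₁]
      ring
    · have ih₂ := ih s
      have h₁ := symmRankCard_succ_add_two (K := K) m (2 * s + 1)
      have h₂ := symmRankCard_succ_add_two (K := K) m (2 * s)
      simp only [mul_add, mul_one, add_assoc, Nat.reduceAdd] at ih₁ ih₂ h₁ h₂ ⊢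
      rw [h₁, h₂]
      linear_combination (Fintype.card K : ℤ) ^ (2 * s + 3) * ih₁ +
        ((Fintype.card K : ℤ) ^ (m + 1) - (Fintype.card K : ℤ) ^ (2 * s + 2)) *
          Fintype.card K * ih₂

theorem card_isSymm_le_rank [Fintype K] (m : ℕ) :
    Nat.card {M : Matrix (Fin (m + 1)) (Fin (m + 1)) K // M.IsSymm ∧ m ≤ M.rank} =
      symmRankCard K (m + 1) m + symmRankCard K (m + 1) (m + 1) := by
  classical
  simp only [symmRankCard, Nat.card_eq_fintype_card, Fintype.card_subtype]
  rw [← Finset.card_union_of_disjoint, ← Finset.filter_or]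
  · congr 1
    refine Finset.filter_congr fun M _ => ?_
    have := M.rank_le_width
    grind
  · exact Finset.disjoint_filter.2 fun M _ h₁ h₂ => by omega

theorem symmRankCard_add_symmRankCard_recursion [Fintype K] (s : ℕ) :
    symmRankCard K (2 * s + 3) (2 * s + 2) + symmRankCard K (2 * s + 3) (2 * s + 3) =
    Fintype.card K ^ (2 * s + 3) *
      (symmRankCard K (2 * s + 2) (2 * s + 1) + symmRankCard K (2 * s + 2) (2 * s + 2)) := by
  have h₁ := symmRankCard_succ_add_two (K := K) (2 * s + 2) (2 * s)
  have h₂ := symmRankCard_succ_add_two (K := K) (2 * s + 2) (2 * s + 1)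
  have h₃ := pow_mul_symmRankCard_two_mul_add_one (K := K) (2 * s + 2) s
  have h₄ : symmRankCard K (2 * s + 2) (2 * s + 3) = 0 := symmRankCard_eq_zero (by omega)
  simp only [add_assoc, Nat.reduceAdd, h₄] at h₁ h₂
  zify
  rw [h₁, h₂]
  push_cast
  linear_combination -(Fintype.card K : ℤ) * h₃

end Matrix

/-- For every prime power `q` (realized as the cardinality of a finite
field `F`) and every odd integer `n ≥ 1`, the number of symmetric `n × n` matrices
over `𝔽_q` of rank at least `n - 1` equals `q^n` times the number of symmetric
`(n−1) × (n−1)` matrices over `𝔽_q` of rank at least `n − 2`. -/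
theorem symm_matrix_rank_ge_card_odd_recursion
    (q n : ℕ) (hn : 1 ≤ n) (hodd : Odd n) (F : Type) [Field F] [Fintype F]
    (hq : Fintype.card F = q) :
    Nat.card {M : Matrix (Fin n) (Fin n) F // M.IsSymm ∧ n - 1 ≤ M.rank} =
      q ^ n *
        Nat.card {M : Matrix (Fin (n - 1)) (Fin (n - 1)) F // M.IsSymm ∧ n - 2 ≤ M.rank} := by
  subst hq
  obtain ⟨s, rfl⟩ := hodd
  rcases s with _ | s
  · have h := Matrix.card_isSymm_le_rank (K := F) 0
    have h₁ := Matrix.symmRankCard_succ_one (K := F) 0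
    have h₀ : Nat.card {M : Matrix (Fin 0) (Fin 0) F // M.IsSymm ∧ 0 ≤ M.rank} =
        Matrix.symmRankCard F 0 0 :=
      Nat.card_congr <| Equiv.subtypeEquivRight fun M => and_congr_right' <| by
        simpa using M.rank_le_width
    refine h.trans ?_
    change _ = Fintype.card F ^ 1 * Nat.card {M : Matrix (Fin 0) (Fin 0) F // M.IsSymm ∧ 0 ≤ M.rank}
    rw [h₀, Matrix.symmRankCard_succ_zero]
    rw [Matrix.symmRankCard_eq_zero zero_lt_one] at h₁
    zify
    linear_combination h₁
  · have h := Matrix.card_isSymm_le_rank (K := F) (2 * s + 2)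
    have h' := Matrix.card_isSymm_le_rank (K := F) (2 * s + 1)
    have := Matrix.symmRankCard_add_symmRankCard_recursion (K := F) s
    exact h.trans (this.trans (congrArg _ h'.symm))
end

section
/- Let K be a field, n ≥ 1, R = K[x_1,…,x_n], and let I ⊆ R be an ideal such that τ := dim_K R/I is finite. If, for some integer m ≥ 0, the K-linear map sending a polynomial of total degree at most m to its residue class in R/I is not surjective, then τ ≥ m + 2. -/
namespace MvPolynomial

variable {σ K A : Type*} [Field K] [CommRing A] [Algebra K A]

/-- The image of the polynomials of total degree at most `m` under an algebra homomorphism. -/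
noncomputable def lowDegreeImage (φ : MvPolynomial σ K →ₐ[K] A) (m : ℕ) : Submodule K A :=
  (restrictTotalDegree σ K m).map φ.toLinearMap

theorem mem_lowDegreeImage {φ : MvPolynomial σ K →ₐ[K] A} {m : ℕ} {a : A} :
    a ∈ lowDegreeImage φ m ↔ ∃ f : MvPolynomial σ K, f.totalDegree ≤ m ∧ φ f = a := by
  simp [lowDegreeImage, mem_restrictTotalDegree]

theorem lowDegreeImage_mono (φ : MvPolynomial σ K →ₐ[K] A) : Monotone (lowDegreeImage φ) := by
  intro m k hmk a ha
  obtain ⟨f, hf, rfl⟩ := mem_lowDegreeImage.1 ha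
  exact mem_lowDegreeImage.2 ⟨f, hf.trans hmk, rfl⟩

theorem map_C_mem_lowDegreeImage (φ : MvPolynomial σ K →ₐ[K] A) (m : ℕ) (c : K) :
    φ (C c) ∈ lowDegreeImage φ m :=
  mem_lowDegreeImage.2 ⟨C c, by simp, rfl⟩

theorem mul_map_X_mem_lowDegreeImage {φ : MvPolynomial σ K →ₐ[K] A} {m : ℕ} {a : A}
    (ha : a ∈ lowDegreeImage φ m) (i : σ) : a * φ (X i) ∈ lowDegreeImage φ (m + 1) := by
  obtain ⟨f, hf, rfl⟩ := mem_lowDegreeImage.1 ha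
  refine mem_lowDegreeImage.2 ⟨f * X i, (totalDegree_mul _ _).trans ?_, map_mul _ _ _⟩
  exact add_le_add hf (totalDegree_X (R := K) i).le

/-- Once the filtration by degree is stationary at one step, it has exhausted the image. -/
theorem lowDegreeImage_eq_top_of_succ_le {φ : MvPolynomial σ K →ₐ[K] A}
    (hφ : Function.Surjective φ) {m : ℕ}
    (h : lowDegreeImage φ (m + 1) ≤ lowDegreeImage φ m) : lowDegreeImage φ m = ⊤ := by
  refine eq_top_iff.2 fun a _ => ?_
  obtain ⟨f, rfl⟩ := hφ a
  induction f using MvPolynomial.induction_on with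
  | C c => exact map_C_mem_lowDegreeImage φ m c
  | add p q hp hq =>
    rw [map_add]
    exact add_mem (hp trivial) (hq trivial)
  | mul_X p i hp =>
    rw [map_mul]
    exact h (mul_map_X_mem_lowDegreeImage (hp trivial) i)

theorem succ_le_finrank_lowDegreeImage [FiniteDimensional K A] {φ : MvPolynomial σ K →ₐ[K] A}
    (hφ : Function.Surjective φ) {m : ℕ} (h : lowDegreeImage φ m ≠ ⊤) :
    m + 1 ≤ Module.finrank K (lowDegreeImage φ m) := by
  induction m with
  | zero =>
    refine Submodule.one_le_finrank_iff.2 fun hbot => h ?_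
    have h1 : (1 : A) = 0 := by
      have := map_C_mem_lowDegreeImage φ 0 1
      rwa [hbot, Submodule.mem_bot, C_1, map_one] at this
    have : Subsingleton A := subsingleton_of_zero_eq_one h1.symm
    exact Subsingleton.elim _ _
  | succ m ih =>
    have hle := lowDegreeImage_mono φ m.le_succ
    have hm : lowDegreeImage φ m ≠ ⊤ := fun ht => h (top_le_iff.1 (ht ▸ hle))
    have hlt : lowDegreeImage φ m < lowDegreeImage φ (m + 1) :=
      lt_of_le_not_ge hle fun hge => hm (lowDegreeImage_eq_top_of_succ_le hφ hge)
    have := Submodule.finrank_lt_finrank_of_lt hlt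
    have := ih hm
    omega

end MvPolynomial

/-- Let `K` be a field, `n ≥ 1`, `R = K[x_1,…,x_n]`, and `I ⊆ R` an
ideal with `τ := dim_K R/I` finite. If for some `m ≥ 0` the map sending a polynomial
of total degree at most `m` to its residue class in `R/I` is not surjective (i.e. the
span `V_m` of these residue classes is not all of `R/I`), then `τ ≥ m + 2`. -/
theorem finrank_ge_of_lowDegree_not_surjective
    (K : Type) [Field K] (n : ℕ) (hn : 1 ≤ n)
    (I : Ideal (MvPolynomial (Fin n) K))
    (hfin : FiniteDimensional K (MvPolynomial (Fin n) K ⧸ I)) (m : ℕ)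
    (h : Submodule.span K
          (Ideal.Quotient.mk I '' {f : MvPolynomial (Fin n) K | f.totalDegree ≤ m}) ≠ ⊤) :
    m + 2 ≤ Module.finrank K (MvPolynomial (Fin n) K ⧸ I) := by
  have hspan : Submodule.span K
      (Ideal.Quotient.mk I '' {f : MvPolynomial (Fin n) K | f.totalDegree ≤ m}) =
      MvPolynomial.lowDegreeImage (Ideal.Quotient.mkₐ K I) m := by
    refine (congrArg _ ?_).trans (Submodule.span_eq _)
    ext a
    simp [MvPolynomial.mem_lowDegreeImage]
  rw [hspan] at h
  have hrank := MvPolynomial.succ_le_finrank_lowDegreeImage (Ideal.Quotient.mkₐ_surjective K I) h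
  have hlt := Submodule.finrank_lt h
  omega
end

section
/- Let K be a field, A a commutative K-algebra, and J ⊆ A an ideal generated by n elements such that A/J is a finite-dimensional K-vector space. Then A/J^3 is a finite-dimensional K-vector space and dim_K (A/J^3) ≤ (n^2 + n + 1) · dim_K (A/J). -/
/-- If `P` is generated by a finite family indexed by `ι` and `A ⧸ P`, `A ⧸ J` are
finite-dimensional, then so is `A ⧸ (P * J)`, of dimension at most
`dim (A ⧸ P) + |ι| * dim (A ⧸ J)`. -/
theorem Ideal.finrank_quotient_span_range_mul_le {K A ι : Type*} [Field K] [CommRing A]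
    [Algebra K A] [Fintype ι] (h : ι → A) (P J : Ideal A) (hP : P = Ideal.span (Set.range h))
    [FiniteDimensional K (A ⧸ P)] [FiniteDimensional K (A ⧸ J)] :
    FiniteDimensional K (A ⧸ (P * J)) ∧ Module.finrank K (A ⧸ (P * J)) ≤
      Module.finrank K (A ⧸ P) + Fintype.card ι * Module.finrank K (A ⧸ J) := by
  obtain ⟨s, hs⟩ := (Ideal.Quotient.mkₐ K P).toLinearMap.exists_rightInverse_of_surjective
    (LinearMap.range_eq_top.2 Ideal.Quotient.mk_surjective)
  obtain ⟨t, ht⟩ := (Ideal.Quotient.mkₐ K J).toLinearMap.exists_rightInverse_of_surjective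
    (LinearMap.range_eq_top.2 Ideal.Quotient.mk_surjective)
  replace hs (x : A ⧸ P) : Ideal.Quotient.mk P (s x) = x := LinearMap.congr_fun hs x
  replace ht (x : A ⧸ J) : Ideal.Quotient.mk J (t x) = x := LinearMap.congr_fun ht x
  let φ : ((A ⧸ P) × (ι → A ⧸ J)) →ₗ[K] A ⧸ (P * J) :=
    (Ideal.Quotient.mkₐ K (P * J)).toLinearMap ∘ₗ
      (s.coprod (∑ i, LinearMap.mulLeft K (h i) ∘ₗ t ∘ₗ LinearMap.proj i))
  have hφ : Function.Surjective φ := by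
    intro z
    obtain ⟨a, rfl⟩ := Ideal.Quotient.mk_surjective z
    have ha : a - s (Ideal.Quotient.mk P a) ∈ P := by
      rw [← Ideal.Quotient.eq, hs]
    obtain ⟨c, hc⟩ := Ideal.mem_span_range_iff_exists_fun.1 (hP.le ha)
    refine ⟨(Ideal.Quotient.mk P a, fun i => Ideal.Quotient.mk J (c i)), ?_⟩
    have hval : φ (Ideal.Quotient.mk P a, fun i => Ideal.Quotient.mk J (c i)) =
        Ideal.Quotient.mk (P * J) (s (Ideal.Quotient.mk P a) +
          ∑ i, h i * t (Ideal.Quotient.mk J (c i))) := by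
      simp [φ]
    rw [hval, eq_comm, Ideal.Quotient.eq, ← sub_sub, ← hc, ← Finset.sum_sub_distrib]
    refine Ideal.sum_mem _ fun i _ => ?_
    rw [mul_comm (c i), ← mul_sub]
    refine Ideal.mul_mem_mul (hP.ge (Ideal.subset_span ⟨i, rfl⟩)) ?_
    rw [← Ideal.Quotient.eq, ht]
  refine ⟨Module.Finite.of_surjective φ hφ, ?_⟩
  simpa [Module.finrank_prod, Module.finrank_pi_fintype] using
    LinearMap.finrank_le_finrank_of_surjective hφ


/-- Let `K` be a field, `A` a commutative `K`-algebra, and `J ⊆ A` an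
ideal generated by `n` elements such that `A/J` is finite-dimensional over `K`.
Then `A/J^3` is finite-dimensional over `K` and
`dim_K (A/J^3) ≤ (n^2 + n + 1) · dim_K (A/J)`. -/
theorem quotient_pow_three_finrank_le
    (K : Type) [Field K] (A : Type) [CommRing A] [Algebra K A]
    (n : ℕ) (hn : 1 ≤ n) (g : Fin n → A) (J : Ideal A)
    (hJ : J = Ideal.span (Set.range g))
    (hfin : FiniteDimensional K (A ⧸ J)) :
    FiniteDimensional K (A ⧸ J ^ 3) ∧
      Module.finrank K (A ⧸ J ^ 3) ≤ (n ^ 2 + n + 1) * Module.finrank K (A ⧸ J) := by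
  have hsq : J ^ 2 = Ideal.span (Set.range fun p : Fin n × Fin n => g p.1 * g p.2) := by
    rw [hJ, pow_two, Ideal.span_mul_span', ← Set.image2_mul, Set.image2_range]
  obtain ⟨hfin₂, hle₂⟩ := Ideal.finrank_quotient_span_range_mul_le (K := K) g J J hJ
  rw [← pow_two] at hfin₂ hle₂
  obtain ⟨hfin₃, hle₃⟩ := Ideal.finrank_quotient_span_range_mul_le (K := K) _ (J ^ 2) J hsq
  rw [← pow_succ] at hfin₃ hle₃
  refine ⟨hfin₃, hle₃.trans ?_⟩
  simp only [Fintype.card_prod, Fintype.card_fin] at hle₂ ⊢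
  linarith
end
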